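/- Lemma 3.2(ii) (coercivity of the imaginary part of the modal PML form): Assume σ₀ ≥ √3, set τ = R^{1/2} / ( (2(1+σ₀²))^{1/2} L^{1/2} ), and assume τ/k ≤ L. If ν ∈ ℝ satisfies ν² < k²R² + λ k R̂², then for every admissible v with v(R̂) = 0, −Im a_ν(v,v) ≥ (1/2) ∫_R^{R̂} ( (σ₀ R / ((1+σ₀²) R̂)) r |v′(r)|² + λ k r |v(r)|² ) dr. -/

import Mathlib

open MeasureTheory

noncomputable section

/-- The PML medium property `σ(r)`: `0` for `0 ≤ r ≤ R` and `σ₀` for `r > R`. -/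
def sigPML (σ₀ R r : ℝ) : ℝ := if r ≤ R then 0 else σ₀

/-- `δ(r) = 0` for `0 ≤ r ≤ R` and `δ(r) = σ₀(r−R)/r` for `r > R`. -/
def delPML (σ₀ R r : ℝ) : ℝ := if r ≤ R then 0 else σ₀ * (r - R) / r

/-- `α(r) = 1 + iσ(r)`. -/
def alphaPML (σ₀ R r : ℝ) : ℂ := 1 + Complex.I * sigPML σ₀ R r

/-- `β(r) = 1 + iδ(r)`. -/
def betaPML (σ₀ R r : ℝ) : ℂ := 1 + Complex.I * delPML σ₀ R r

/-- `λ = R^{3/2} / (3 σ₀ R̂² L^{1/2})` with `L = R̂ − R`. -/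
def lamPML (σ₀ R Rh : ℝ) : ℝ := R ^ ((3 : ℝ) / 2) / (3 * σ₀ * Rh ^ 2 * (Rh - R) ^ ((1 : ℝ) / 2))

/-- A function `v : (0, R̂] → ℂ` is admissible if it is locally absolutely continuous with
derivative `v′` and the integrals `∫₀^{R̂} r|v′|²`, `∫₀^{R̂} (1/r)|v|²`, `∫₀^{R̂} r|v|²` are
all finite. -/
def Admissible (Rh : ℝ) (v v' : ℝ → ℂ) : Prop :=
  AEStronglyMeasurable v' (volume.restrict (Set.Ioc 0 Rh)) ∧
  (∀ a b : ℝ, 0 < a → a ≤ b → b ≤ Rh → v b - v a = ∫ t in a..b, v' t) ∧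
  IntegrableOn (fun r => r * ‖v' r‖ ^ 2) (Set.Ioc 0 Rh) ∧
  IntegrableOn (fun r => ‖v r‖ ^ 2 / r) (Set.Ioc 0 Rh) ∧
  IntegrableOn (fun r => r * ‖v r‖ ^ 2) (Set.Ioc 0 Rh)

/-- The modal PML sesquilinear form evaluated at `(v, v)`:
`a_ν(v,v) = ∫₀^{R̂} ((β/α) r |v′|² + ((ν²/r)(α/β) − k²αβr) |v|²) dr`. -/
def aForm (k σ₀ R Rh ν : ℝ) (v v' : ℝ → ℂ) : ℂ :=
  ∫ r in Set.Ioc 0 Rh,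
    ((betaPML σ₀ R r / alphaPML σ₀ R r) * (r : ℂ) * (‖v' r‖ ^ 2 : ℝ) +
      (((ν ^ 2 : ℝ) / r) * (alphaPML σ₀ R r / betaPML σ₀ R r) -
        (k ^ 2 : ℝ) * alphaPML σ₀ R r * betaPML σ₀ R r * r) * (‖v r‖ ^ 2 : ℝ))

/-- Poincaré-type bound for a locally absolutely continuous function vanishing at the right
endpoint of `(a, b]`. -/
lemma norm_sq_le_mul_integral_of_eq_zero {a b r : ℝ} {v v' : ℝ → ℂ} (har : a ≤ r) (hrb : r ≤ b)
    (hab : a < b) (hftc : v b - v r = ∫ t in r..b, v' t) (hvb : v b = 0)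
    (hint : IntegrableOn (fun t => ‖v' t‖ ^ 2) (Set.Ioc a b)) :
    ‖v r‖ ^ 2 ≤ (b - a) * ∫ t in Set.Ioc a b, ‖v' t‖ ^ 2 := by
  set E := ∫ t in Set.Ioc a b, ‖v' t‖ ^ 2 with hE
  have hE0 : 0 ≤ E := integral_nonneg fun t => by positivity
  have hL : 0 < b - a := sub_pos.2 hab
  rcases (norm_nonneg (v r)).eq_or_lt with h0 | hpos
  · rw [← h0]; nlinarith [mul_nonneg hL.le hE0]
  set A := ‖v r‖ with hA
  set t := A / (b - a) with ht
  have htpos : 0 < t := by positivity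
  have hsub : Set.Ioc r b ⊆ Set.Ioc a b := Set.Ioc_subset_Ioc_left har
  have hg : IntegrableOn (fun s => (t ^ 2 + ‖v' s‖ ^ 2) / (2 * t)) (Set.Ioc a b) :=
    ((integrable_const _).add hint).div_const _
  have hbound : A ≤ ∫ s in Set.Ioc r b, (t ^ 2 + ‖v' s‖ ^ 2) / (2 * t) := by
    have : A = ‖∫ s in Set.Ioc r b, v' s‖ := by
      rw [← intervalIntegral.integral_of_le hrb, ← hftc, hvb, zero_sub, norm_neg]
    rw [this]
    refine norm_integral_le_of_norm_le (hg.mono_set hsub) (Filter.Eventually.of_forall fun s => ?_)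
    rw [le_div_iff₀ (by positivity)]
    nlinarith [sq_nonneg (t - ‖v' s‖)]
  have hmono : ∫ s in Set.Ioc r b, (t ^ 2 + ‖v' s‖ ^ 2) / (2 * t)
      ≤ ∫ s in Set.Ioc a b, (t ^ 2 + ‖v' s‖ ^ 2) / (2 * t) :=
    setIntegral_mono_set hg
      (Filter.Eventually.of_forall fun s => by simp only [Pi.zero_apply]; positivity)
      hsub.eventuallyLE
  have hval : ∫ s in Set.Ioc a b, (t ^ 2 + ‖v' s‖ ^ 2) / (2 * t)
      = ((b - a) * t ^ 2 + E) / (2 * t) := by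
    rw [integral_div, integral_add (integrable_const _) hint]
    simp [hab.le, hE]
  have key : A ≤ ((b - a) * t ^ 2 + E) / (2 * t) := by linarith
  rw [le_div_iff₀ (by positivity)] at key
  have htA : (b - a) * t = A := by rw [ht]; field_simp
  have h2 : A * t ≤ E := by nlinarith
  calc A ^ 2 = (b - a) * (A * t) := by rw [← mul_left_comm, htA]; ring
    _ ≤ (b - a) * E := by gcongr

lemma measurable_sigPML (σ₀ R : ℝ) : Measurable (sigPML σ₀ R) :=
  Measurable.ite measurableSet_Iic measurable_const measurable_const

lemma measurable_delPML (σ₀ R : ℝ) : Measurable (delPML σ₀ R) :=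
  Measurable.ite measurableSet_Iic measurable_const (by fun_prop)

lemma measurable_alphaPML (σ₀ R : ℝ) : Measurable (alphaPML σ₀ R) :=
  measurable_const.add
    (measurable_const.mul (Complex.measurable_ofReal.comp (measurable_sigPML σ₀ R)))

lemma measurable_betaPML (σ₀ R : ℝ) : Measurable (betaPML σ₀ R) :=
  measurable_const.add
    (measurable_const.mul (Complex.measurable_ofReal.comp (measurable_delPML σ₀ R)))

lemma norm_alphaPML_le {σ₀ : ℝ} (hσ₀ : 0 ≤ σ₀) (R r : ℝ) : ‖alphaPML σ₀ R r‖ ≤ 1 + σ₀ := by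
  refine (norm_add_le _ _).trans ?_
  rw [norm_one, norm_mul, Complex.norm_I, one_mul, Complex.norm_real, sigPML]
  split_ifs <;> simp [abs_of_nonneg, hσ₀]

lemma norm_betaPML_le {σ₀ R : ℝ} (hσ₀ : 0 ≤ σ₀) (hR : 0 ≤ R) (r : ℝ) :
    ‖betaPML σ₀ R r‖ ≤ 1 + σ₀ := by
  refine (norm_add_le _ _).trans ?_
  rw [norm_one, norm_mul, Complex.norm_I, one_mul, Complex.norm_real, delPML]
  split_ifs with h
  · simp [hσ₀]
  · push Not at h
    have hr : 0 < r := hR.trans_lt h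
    rw [Real.norm_of_nonneg (div_nonneg (mul_nonneg hσ₀ (by linarith)) hr.le)]
    gcongr
    rw [div_le_iff₀ hr]
    nlinarith [mul_nonneg hσ₀ hR]

lemma one_le_norm_one_add_I_mul (x : ℝ) : 1 ≤ ‖(1 + Complex.I * x : ℂ)‖ := by
  simpa using Complex.re_le_norm (1 + Complex.I * x : ℂ)

lemma integrableOn_aForm_integrand {σ₀ R Rh : ℝ} {v v' : ℝ → ℂ} (k ν : ℝ) (hσ₀ : 0 ≤ σ₀)
    (hR : 0 ≤ R) (hv : Admissible Rh v v') :
    IntegrableOn (fun r : ℝ =>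
      ((betaPML σ₀ R r / alphaPML σ₀ R r) * (r : ℂ) * (‖v' r‖ ^ 2 : ℝ) +
        (((ν ^ 2 : ℝ) / r) * (alphaPML σ₀ R r / betaPML σ₀ R r) -
          (k ^ 2 : ℝ) * alphaPML σ₀ R r * betaPML σ₀ R r * r) * (‖v r‖ ^ 2 : ℝ)))
      (Set.Ioc 0 Rh) := by
  obtain ⟨-, -, h1, h2, h3⟩ := hv
  have hα := measurable_alphaPML σ₀ R
  have hβ := measurable_betaPML σ₀ R
  have e1 := Integrable.bdd_mul (c := 1 + σ₀) (f := fun r => betaPML σ₀ R r / alphaPML σ₀ R r)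
    h1.ofReal (hβ.div hα).aestronglyMeasurable (Filter.Eventually.of_forall fun r => by
      rw [norm_div]
      exact (div_le_self (norm_nonneg _) (one_le_norm_one_add_I_mul _)).trans
        (norm_betaPML_le hσ₀ hR r))
  have e2 := (Integrable.bdd_mul (c := 1 + σ₀)
    (f := fun r => alphaPML σ₀ R r / betaPML σ₀ R r)
    h2.ofReal (hα.div hβ).aestronglyMeasurable (Filter.Eventually.of_forall fun r => by
      rw [norm_div]
      exact (div_le_self (norm_nonneg _) (one_le_norm_one_add_I_mul _)).trans
        (norm_alphaPML_le hσ₀ R r))).const_mul ((ν ^ 2 : ℝ) : ℂ)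
  have e3 := (Integrable.bdd_mul (c := (1 + σ₀) * (1 + σ₀))
    (f := fun r => alphaPML σ₀ R r * betaPML σ₀ R r)
    h3.ofReal (hα.mul hβ).aestronglyMeasurable (Filter.Eventually.of_forall fun r => by
      rw [norm_mul]
      exact mul_le_mul (norm_alphaPML_le hσ₀ R r) (norm_betaPML_le hσ₀ hR r) (norm_nonneg _)
        (by positivity))).const_mul ((k ^ 2 : ℝ) : ℂ)
  refine ((e1.add e2).sub e3).congr (Filter.Eventually.of_forall fun r => ?_)
  simp only [Pi.add_apply, Pi.sub_apply, Complex.coe_algebraMap, RCLike.ofReal_mul,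
    RCLike.ofReal_div]
  push_cast
  ring

lemma im_aForm_integrand_of_le {σ₀ R r : ℝ} (k ν x y : ℝ) (hr : r ≤ R) :
    ((betaPML σ₀ R r / alphaPML σ₀ R r) * (r : ℂ) * (x : ℝ) +
        (((ν ^ 2 : ℝ) / r) * (alphaPML σ₀ R r / betaPML σ₀ R r) -
          (k ^ 2 : ℝ) * alphaPML σ₀ R r * betaPML σ₀ R r * r) * (y : ℝ)).im = 0 := by
  have hα : alphaPML σ₀ R r = 1 := by simp [alphaPML, sigPML, hr]
  have hβ : betaPML σ₀ R r = 1 := by simp [betaPML, delPML, hr]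
  rw [hα, hβ]
  have : ((1 : ℂ) / 1 * (r : ℂ) * (x : ℝ) + (((ν ^ 2 : ℝ) / r) * ((1 : ℂ) / 1) -
      (k ^ 2 : ℝ) * 1 * 1 * r) * (y : ℝ))
      = ((r * x + (ν ^ 2 / r - k ^ 2 * r) * y : ℝ) : ℂ) := by
    push_cast; ring
  rw [this, Complex.ofReal_im]

lemma im_aForm_integrand_of_lt {σ₀ R r : ℝ} (k ν x y : ℝ) (hR : 0 < R) (hr : R < r) :
    -((betaPML σ₀ R r / alphaPML σ₀ R r) * (r : ℂ) * (x : ℝ) +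
        (((ν ^ 2 : ℝ) / r) * (alphaPML σ₀ R r / betaPML σ₀ R r) -
          (k ^ 2 : ℝ) * alphaPML σ₀ R r * betaPML σ₀ R r * r) * (y : ℝ)).im =
      σ₀ * R / (1 + σ₀ ^ 2) * x +
        σ₀ * (k ^ 2 * (2 * r - R) - ν ^ 2 * R / (r ^ 2 + σ₀ ^ 2 * (r - R) ^ 2)) * y := by
  have hr0 : 0 < r := hR.trans hr
  set d := σ₀ * (r - R) / r with hd
  have hα : alphaPML σ₀ R r = 1 + Complex.I * σ₀ := by simp [alphaPML, sigPML, hr.not_ge]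
  have hβ : betaPML σ₀ R r = 1 + Complex.I * d := by simp [betaPML, delPML, hr.not_ge, hd]
  have hdiv (s t : ℝ) : (1 + Complex.I * s) / (1 + Complex.I * t)
      = (((1 + s * t) / (1 + t ^ 2) : ℝ) : ℂ) + Complex.I * (((s - t) / (1 + t ^ 2) : ℝ) : ℂ) := by
    have h1 : (1 + Complex.I * t : ℂ) ≠ 0 := fun h => by
      have := congrArg Complex.re h; simp at this
    have h2 : ((1 + t ^ 2 : ℝ) : ℂ) ≠ 0 := Complex.ofReal_ne_zero.2 (by positivity)
    push_cast at h2 ⊢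
    field_simp
    linear_combination ((t : ℂ) ^ 2 - t * s) * Complex.I_sq
  have hmul : (betaPML σ₀ R r / alphaPML σ₀ R r) * (r : ℂ) * (x : ℝ) +
        (((ν ^ 2 : ℝ) / r) * (alphaPML σ₀ R r / betaPML σ₀ R r) -
          (k ^ 2 : ℝ) * alphaPML σ₀ R r * betaPML σ₀ R r * r) * (y : ℝ)
      = (((1 + d * σ₀) / (1 + σ₀ ^ 2) * r * x + (ν ^ 2 / r * ((1 + σ₀ * d) / (1 + d ^ 2))
          - k ^ 2 * (1 - σ₀ * d) * r) * y : ℝ) : ℂ)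
        + (((d - σ₀) / (1 + σ₀ ^ 2) * r * x + (ν ^ 2 / r * ((σ₀ - d) / (1 + d ^ 2))
          - k ^ 2 * (σ₀ + d) * r) * y : ℝ) : ℂ) * Complex.I := by
    rw [hα, hβ, hdiv, hdiv]
    push_cast
    linear_combination (-(k : ℂ) ^ 2 * σ₀ * d * r * y) * Complex.I_sq
  rw [hmul, Complex.add_im, Complex.ofReal_im, Complex.im_ofReal_mul, Complex.I_im]
  have h1 : (d - σ₀) * r = -(σ₀ * R) := by rw [hd]; field_simp; ring
  have h2 : (σ₀ + d) * r = σ₀ * (2 * r - R) := by rw [hd]; field_simp; ring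
  have h3 : ν ^ 2 / r * ((σ₀ - d) / (1 + d ^ 2))
      = σ₀ * (ν ^ 2 * R / (r ^ 2 + σ₀ ^ 2 * (r - R) ^ 2)) := by
    have h4 : r ^ 2 + σ₀ ^ 2 * (r - R) ^ 2 = r ^ 2 * (1 + d ^ 2) := by rw [hd]; field_simp
    have h5 : σ₀ - d = σ₀ * R / r := by rw [hd]; field_simp; ring
    have h6 : 1 + d ^ 2 ≠ 0 := by positivity
    rw [h4, h5]
    field_simp
  rw [h3]
  linear_combination (-(x / (1 + σ₀ ^ 2))) * h1 + k ^ 2 * y * h2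

/-- Up to the constant coming from the excess of `ν²` over `k²R²`, the zeroth-order weight of the
imaginary part grows linearly in the layer. -/
lemma weight_lower_bound {k σ R Rh ν l r : ℝ} (hk : 0 < k) (hσ : 0 < σ) (hR : 0 < R) (hl : 0 ≤ l)
    (hν : ν ^ 2 ≤ k ^ 2 * R ^ 2 + l * k * Rh ^ 2) (hr : R < r) (hrRh : r ≤ Rh) :
    2 * σ * k ^ 2 * (r - R) - (σ + 1 / 2) * (l * k * Rh ^ 2 / R) ≤
      σ * (k ^ 2 * (2 * r - R) - ν ^ 2 * R / (r ^ 2 + σ ^ 2 * (r - R) ^ 2))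
        - l * k * r / 2 := by
  have hr0 : 0 < r := hR.trans hr
  have hD : R ^ 2 ≤ r ^ 2 + σ ^ 2 * (r - R) ^ 2 := by
    nlinarith [sq_nonneg (σ * (r - R))]
  have h1 : ν ^ 2 * R / (r ^ 2 + σ ^ 2 * (r - R) ^ 2)
      ≤ k ^ 2 * R + l * k * Rh ^ 2 / R := by
    calc ν ^ 2 * R / (r ^ 2 + σ ^ 2 * (r - R) ^ 2)
        ≤ ν ^ 2 * R / R ^ 2 := by gcongr
      _ ≤ (k ^ 2 * R ^ 2 + l * k * Rh ^ 2) * R / R ^ 2 := by gcongr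
      _ = k ^ 2 * R + l * k * Rh ^ 2 / R := by field_simp
  have h2 : l * k * r ≤ l * k * Rh ^ 2 / R := by
    rw [le_div_iff₀ hR, mul_assoc]
    have : r * R ≤ Rh ^ 2 := by nlinarith
    gcongr
  nlinarith [mul_le_mul_of_nonneg_left h1 hσ.le]

lemma add_half_mul_sqrt_le {σ : ℝ} (hσ : Real.sqrt 3 ≤ σ) {c : ℝ}
    (hc2 : c ^ 2 = 2 * (1 + σ ^ 2)) : (σ + 1 / 2) * c ≤ 3 * σ ^ 2 := by
  have h3 : 3 ≤ σ ^ 2 := by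
    have := Real.sq_sqrt (show (0 : ℝ) ≤ 3 by norm_num)
    nlinarith [Real.sqrt_nonneg 3]
  have hσ0 : 0 ≤ σ := (Real.sqrt_nonneg 3).trans hσ
  have h1 : 1 ≤ σ := by nlinarith
  have hc5 : c ≤ 5 / 3 * σ := abs_le_of_sq_le_sq' (by nlinarith) (by positivity) |>.2
  nlinarith

/-- The constants of the PML layer: `λ ≥ 0`, the thickness `τ/k` is positive, the linear weight
absorbs the negative zeroth-order constant beyond `R + τ/k`, and half of the gradient term absorbs
it before. -/
lemma lamPML_bounds {k σ₀ R Rh : ℝ} (hk : 0 < k) (hσ₀ : 0 < σ₀) (hσ₀' : Real.sqrt 3 ≤ σ₀)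
    (hR : 0 < R) (hRRh : R < Rh) {h : ℝ}
    (hh : h = (R ^ ((1 : ℝ) / 2) /
      ((2 * (1 + σ₀ ^ 2)) ^ ((1 : ℝ) / 2) * (Rh - R) ^ ((1 : ℝ) / 2))) / k) :
    0 ≤ lamPML σ₀ R Rh ∧ 0 < h ∧
      (σ₀ + 1 / 2) * (lamPML σ₀ R Rh * k * Rh ^ 2 / R) ≤ 2 * σ₀ * k ^ 2 * h ∧
      (σ₀ + 1 / 2) * (lamPML σ₀ R Rh * k * Rh ^ 2 / R) * h * (Rh - R) ≤
        σ₀ * R / (1 + σ₀ ^ 2) / 2 := by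
  have hL : 0 < Rh - R := sub_pos.2 hRRh
  set a := R ^ ((1 : ℝ) / 2) with ha
  set b := (Rh - R) ^ ((1 : ℝ) / 2) with hb
  set c := (2 * (1 + σ₀ ^ 2)) ^ ((1 : ℝ) / 2) with hc
  have ha0 : 0 < a := by positivity
  have hb0 : 0 < b := by positivity
  have hc0 : 0 < c := by positivity
  have hsq {x : ℝ} (hx : 0 ≤ x) : (x ^ ((1 : ℝ) / 2)) ^ 2 = x := by
    rw [← Real.sqrt_eq_rpow, Real.sq_sqrt hx]
  have ha2 : a ^ 2 = R := hsq hR.le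
  have hb2 : b ^ 2 = Rh - R := hsq hL.le
  have hc2 : c ^ 2 = 2 * (1 + σ₀ ^ 2) := hsq (by positivity)
  have hRh : 0 < Rh := hR.trans hRRh
  set l := lamPML σ₀ R Rh with hl
  have hlval : l = a ^ 3 / (3 * σ₀ * Rh ^ 2 * b) := by
    have ha3 : R ^ ((3 : ℝ) / 2) = a ^ 3 := by
      rw [ha, ← Real.rpow_mul_natCast hR.le]
      norm_num
    rw [hl, lamPML, ← hb, ha3]
  have hl0 : 0 ≤ l := by rw [hlval]; positivity
  have hnum := add_half_mul_sqrt_le hσ₀' hc2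
  have hh0 : 0 < h := by rw [hh]; positivity
  set C := (σ₀ + 1 / 2) * (l * k * Rh ^ 2 / R) with hC
  have hCval : C = (σ₀ + 1 / 2) * k * a / (3 * σ₀ * b) := by
    rw [hC, hlval, ← ha2]; field_simp
  have hCfar : C ≤ 2 * σ₀ * k ^ 2 * h := by
    have : 2 * σ₀ * k ^ 2 * h = 2 * σ₀ * k * a / (c * b) := by rw [hh]; field_simp
    rw [hCval, this, div_le_div_iff₀ (by positivity) (by positivity)]
    have : 0 ≤ k * a * b := by positivity
    nlinarith [mul_le_mul_of_nonneg_left hnum this, mul_nonneg this (sq_nonneg σ₀)]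
  have hCnear : C * h * (Rh - R) ≤ σ₀ * R / (1 + σ₀ ^ 2) / 2 := by
    have e1 : C * h * (Rh - R) = (σ₀ + 1 / 2) * R / (3 * σ₀ * c) := by
      rw [hCval, hh, ← hb2, ← ha2]; field_simp
    have e2 : σ₀ * R / (1 + σ₀ ^ 2) / 2 = σ₀ * R / c ^ 2 := by rw [hc2, div_div, mul_comm 2]
    rw [e1, e2, div_le_div_iff₀ (by positivity) (by positivity)]
    have : 0 ≤ R * c := by positivity
    nlinarith [mul_le_mul_of_nonneg_left hnum this]
  exact ⟨hl0, hh0, hCfar, hCnear⟩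

/-- Lemma 3.2(ii) (coercivity of the imaginary part of the modal PML form): if `σ₀ ≥ √3`,
`τ = R^{1/2}/((2(1+σ₀²))^{1/2} L^{1/2})` satisfies `τ/k ≤ L`, and `ν² < k²R² + λkR̂²`,
then for every admissible `v` with `v(R̂) = 0`,
`−Im a_ν(v,v) ≥ (1/2) ∫_R^{R̂} ((σ₀R/((1+σ₀²)R̂)) r |v′|² + λ k r |v|²) dr`. -/
theorem modal_form_im_coercive (k σ₀ R Rh ν : ℝ) (v v' : ℝ → ℂ)
    (hk : 0 < k) (hσ₀ : 0 < σ₀) (hσ₀' : Real.sqrt 3 ≤ σ₀) (hR : 0 < R) (hRRh : R < Rh)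
    (hτ : (R ^ ((1 : ℝ) / 2) / ((2 * (1 + σ₀ ^ 2)) ^ ((1 : ℝ) / 2) * (Rh - R) ^ ((1 : ℝ) / 2))) / k
            ≤ Rh - R)
    (hν : ν ^ 2 < k ^ 2 * R ^ 2 + lamPML σ₀ R Rh * k * Rh ^ 2)
    (hv : Admissible Rh v v') (hvRh : v Rh = 0) :
    (1 / 2) * (∫ r in Set.Ioc R Rh,
        ((σ₀ * R / ((1 + σ₀ ^ 2) * Rh)) * r * ‖v' r‖ ^ 2 +
          lamPML σ₀ R Rh * k * (r * ‖v r‖ ^ 2))) ≤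
      -(aForm k σ₀ R Rh ν v v').im := by
  have hL : 0 < Rh - R := sub_pos.2 hRRh
  have hRh : 0 < Rh := hR.trans hRRh
  set h := R ^ ((1 : ℝ) / 2) /
    ((2 * (1 + σ₀ ^ 2)) ^ ((1 : ℝ) / 2) * (Rh - R) ^ ((1 : ℝ) / 2)) / k with hh
  obtain ⟨hl0, hh0, hCfar, hCnear⟩ := lamPML_bounds hk hσ₀ hσ₀' hR hRRh hh
  clear_value h
  set l := lamPML σ₀ R Rh
  set C := (σ₀ + 1 / 2) * (l * k * Rh ^ 2 / R) with hC
  have hC0 : 0 ≤ C := by positivity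
  have hFint := integrableOn_aForm_integrand k ν hσ₀.le hR.le hv
  obtain ⟨-, hftc, hv1, -, hv3⟩ := hv
  have hsub : Set.Ioc R Rh ⊆ Set.Ioc 0 Rh := Set.Ioc_subset_Ioc_left hR.le
  have hv1R := hv1.mono_set hsub
  have hv3R := hv3.mono_set hsub
  have hdint : IntegrableOn (fun r => ‖v' r‖ ^ 2) (Set.Ioc R Rh) := by
    refine (Integrable.bdd_mul (c := R⁻¹) (f := fun r : ℝ => r⁻¹) hv1R
      measurable_inv.aestronglyMeasurable ?_).congr ?_
    · filter_upwards [ae_restrict_mem measurableSet_Ioc] with r hr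
      have : 0 < r := hR.trans hr.1
      rw [norm_inv, Real.norm_of_nonneg this.le]
      exact inv_anti₀ hR hr.1.le
    · filter_upwards [ae_restrict_mem measurableSet_Ioc] with r hr
      have : 0 < r := hR.trans hr.1
      field_simp
  set E := ∫ t in Set.Ioc R Rh, ‖v' t‖ ^ 2 with hE
  have hE0 : 0 ≤ E := integral_nonneg fun t => by positivity
  have hIm : -(aForm k σ₀ R Rh ν v v').im = ∫ r in Set.Ioc R Rh,
      -((betaPML σ₀ R r / alphaPML σ₀ R r) * (r : ℂ) * (‖v' r‖ ^ 2 : ℝ) +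
        (((ν ^ 2 : ℝ) / r) * (alphaPML σ₀ R r / betaPML σ₀ R r) -
          (k ^ 2 : ℝ) * alphaPML σ₀ R r * betaPML σ₀ R r * r) * (‖v r‖ ^ 2 : ℝ)).im := by
    rw [integral_neg, aForm]
    congr 1
    refine (integral_im hFint).symm.trans ?_
    refine setIntegral_eq_of_subset_of_forall_sdiff_eq_zero measurableSet_Ioc hsub fun r hr => ?_
    refine im_aForm_integrand_of_le k ν _ _ ?_
    by_contra hlt
    exact hr.2 ⟨not_le.1 hlt, hr.1.2⟩
  rw [hIm, ← integral_const_mul, ← sub_nonneg]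
  have hG : IntegrableOn (fun r => 1 / 2 * ((σ₀ * R / ((1 + σ₀ ^ 2) * Rh)) * r * ‖v' r‖ ^ 2 +
          l * k * (r * ‖v r‖ ^ 2))) (Set.Ioc R Rh) := by
    refine Integrable.const_mul (Integrable.add ?_ (hv3R.const_mul _)) _
    simpa only [mul_assoc] using hv1R.const_mul (σ₀ * R / ((1 + σ₀ ^ 2) * Rh))
  refine le_of_le_of_eq ?_ (integral_sub (hFint.mono_set hsub).im.neg hG)
  have hind : IntegrableOn ((Set.Ioc R (R + h)).indicator fun _ => C * ((Rh - R) * E))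
      (Set.Ioc R Rh) := (integrable_const _).indicator measurableSet_Ioc
  have hlow : 0 ≤ ∫ r in Set.Ioc R Rh, (σ₀ * R / (1 + σ₀ ^ 2) / 2 * ‖v' r‖ ^ 2 -
      (Set.Ioc R (R + h)).indicator (fun _ => C * ((Rh - R) * E)) r) := by
    rw [integral_sub (hdint.const_mul _) hind, integral_const_mul,
      setIntegral_indicator measurableSet_Ioc,
      Set.inter_eq_right.2 (Set.Ioc_subset_Ioc_right (by linarith)), setIntegral_const,
      ← hE]
    simp only [measureReal_def, Real.volume_Ioc, add_sub_cancel_left, ENNReal.toReal_ofReal hh0.le,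
      smul_eq_mul]
    nlinarith [mul_le_mul_of_nonneg_right hCnear hE0]
  refine hlow.trans (setIntegral_mono_on ((hdint.const_mul _).sub hind)
    ((hFint.mono_set hsub).im.neg.sub hG) measurableSet_Ioc fun r hr => ?_)
  have hr0 : 0 < r := hR.trans hr.1
  have hpt : ‖v r‖ ^ 2 ≤ (Rh - R) * E :=
    norm_sq_le_mul_integral_of_eq_zero hr.1.le hr.2 hRRh (hftc r Rh hr0 hr.2 le_rfl) hvRh hdint
  have hgrad : σ₀ * R / ((1 + σ₀ ^ 2) * Rh) * r * ‖v' r‖ ^ 2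
      ≤ σ₀ * R / (1 + σ₀ ^ 2) * ‖v' r‖ ^ 2 := by
    gcongr
    rw [← div_div, div_mul_eq_mul_div, div_le_iff₀ hRh]
    gcongr
    exact hr.2
  have hw := weight_lower_bound hk hσ₀ hR hl0 hν.le hr.1 hr.2
  rw [← hC] at hw
  have hwv := mul_le_mul_of_nonneg_right hw (sq_nonneg ‖v r‖)
  have hzero : -(Set.Ioc R (R + h)).indicator (fun _ => C * ((Rh - R) * E)) r
      ≤ (2 * σ₀ * k ^ 2 * (r - R) - C) * ‖v r‖ ^ 2 := by
    by_cases hrh : r ≤ R + h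
    · rw [Set.indicator_of_mem (Set.mem_Ioc.2 ⟨hr.1, hrh⟩)]
      have : 0 ≤ 2 * σ₀ * k ^ 2 * (r - R) * ‖v r‖ ^ 2 :=
        mul_nonneg (mul_nonneg (by positivity) (sub_nonneg.2 hr.1.le)) (sq_nonneg _)
      nlinarith [mul_le_mul_of_nonneg_left hpt hC0]
    · rw [Set.indicator_of_notMem fun hm => hrh hm.2, neg_zero]
      refine mul_nonneg (sub_nonneg.2 (hCfar.trans ?_)) (sq_nonneg _)
      gcongr
      linarith
  change _ ≤ -(Complex.im _) - _
  rw [im_aForm_integrand_of_lt k ν _ _ hR hr.1]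
  linarith

end
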